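/- arXiv:1904.04157 — 3 statements merged into one kernel-verified Lean document; each statement's English description precedes it below -/
import Mathlib

section
/- For every 1 ≤ m ≤ n, the Gårding cone K_m(n) is a convex cone in the space of real symmetric n×n matrices: it is closed under multiplication by positive scalars and under convex combinations. -/
open Matrix

/-- The `p`-trace of a square real matrix: the sum of all `p × p` principal minors.
    `ptrace 0 S = 1`. -/
noncomputable def ptrace {ι : Type*} [Fintype ι] (p : ℕ) (S : Matrix ι ι ℝ) : ℝ := by
  classical
  exact ∑ t ∈ Finset.univ.powersetCard p,
    (S.submatrix (Subtype.val : {x // x ∈ t} → ι) Subtype.val).det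

/-- The Gårding cone `K_m(n)`: real symmetric `n × n` matrices with `T_p > 0`
    for `p = 1, …, m`. -/
noncomputable def gardingCone (n m : ℕ) : Set (Matrix (Fin n) (Fin n) ℝ) :=
  {S | S.IsSymm ∧ ∀ p, 1 ≤ p → p ≤ m → 0 < ptrace p S}

open Polynomial in
/-- **Laguerre's inequality** for real-rooted polynomials. -/
theorem Polynomial.Splits.eval_mul_eval_derivative_derivative_le {f : ℝ[X]} (hf : f.Splits)
    (t : ℝ) :
    f.eval t * f.derivative.derivative.eval t ≤ f.derivative.eval t ^ 2 := by
  obtain ⟨m, hm⟩ := splits_iff_exists_multiset.1 hf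
  rw [hm]
  generalize f.leadingCoeff = a
  clear hm hf f
  induction m using Multiset.induction_on with
  | empty => simp
  | cons r m ih =>
    rw [Multiset.map_cons, Multiset.prod_cons, mul_left_comm]
    generalize C a * (m.map fun b => X - C b).prod = g at ih
    simp only [derivative_mul, derivative_add, derivative_sub, derivative_X, derivative_C,
      eval_add, eval_mul, eval_sub, eval_X, eval_C, sub_zero, one_mul]
    nlinarith [mul_le_mul_of_nonneg_left ih (sq_nonneg (t - r)), sq_nonneg (g.eval t)]

open Polynomial in
theorem Polynomial.Splits.derivative_of_real {f : ℝ[X]} (hf : f.Splits) :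
    f.derivative.Splits := by
  rw [splits_iff_card_roots] at hf ⊢
  have h₁ := card_roots_le_derivative f
  have h₂ := card_roots' f.derivative
  have h₃ := natDegree_derivative_le f
  rcases Nat.eq_zero_or_pos f.natDegree with h | h <;> omega

open Polynomial in
/-- Consecutive coefficients of a real-rooted polynomial satisfy Newton's inequality. -/
theorem Polynomial.Splits.coeff_mul_coeff_le_sq {f : ℝ[X]} (hf : f.Splits) (k : ℕ) :
    f.coeff k * f.coeff (k + 2) ≤ f.coeff (k + 1) ^ 2 := by
  have hsplit : (derivative^[k] f).Splits := by
    induction k with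
    | zero => simpa using hf
    | succ k ih =>
      rw [Function.iterate_succ_apply']
      exact ih.derivative_of_real
  have h := hsplit.eval_mul_eval_derivative_derivative_le 0
  simp only [← coeff_zero_eq_eval_zero, ← Function.iterate_succ_apply' derivative,
    coeff_iterate_derivative, zero_add, Nat.descFactorial_self, nsmul_eq_mul,
    Nat.succ_eq_add_one, Nat.factorial_succ, Nat.cast_mul, Nat.cast_add, Nat.cast_one] at h
  have hk : (0 : ℝ) < (k.factorial : ℝ) ^ 2 * (k + 1) := by positivity
  have h' : f.coeff k * f.coeff (k + 2) * (k + 2) ≤ f.coeff (k + 1) ^ 2 * (k + 1) := by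
    refine le_of_mul_le_mul_left ?_ hk
    linear_combination h
  by_contra! hlt
  have h0 : (0 : ℝ) ≤ k := k.cast_nonneg
  nlinarith [sq_nonneg (f.coeff (k + 1))]

section ElementarySymmetric

variable {ι : Type*}

/-- The `k`-th elementary symmetric function of the numbers `x i`, `i ∈ s`. -/
def esymmOn (s : Finset ι) (k : ℕ) (x : ι → ℝ) : ℝ :=
  ∑ t ∈ s.powersetCard k, ∏ i ∈ t, x i

@[simp]
theorem esymmOn_zero (s : Finset ι) (x : ι → ℝ) : esymmOn s 0 x = 1 := by
  simp [esymmOn]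

theorem esymmOn_one (s : Finset ι) (x : ι → ℝ) : esymmOn s 1 x = ∑ i ∈ s, x i := by
  simp [esymmOn, Finset.powersetCard_one]

theorem esymmOn_smul (s : Finset ι) (k : ℕ) (c : ℝ) (x : ι → ℝ) :
    esymmOn s k (c • x) = c ^ k * esymmOn s k x := by
  rw [esymmOn, esymmOn, Finset.mul_sum]
  refine Finset.sum_congr rfl fun t ht => ?_
  simp [Finset.prod_mul_distrib, (Finset.mem_powersetCard.1 ht).2]

theorem esymmOn_univ_comp_perm [Fintype ι] (k : ℕ) (σ : Equiv.Perm ι) (x : ι → ℝ) :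
    esymmOn Finset.univ k (x ∘ σ) = esymmOn Finset.univ k x := by
  classical
  refine Finset.sum_bij (fun t _ => t.map σ.toEmbedding) (by simp [Finset.mem_powersetCard])
    (fun _ _ _ _ h => Finset.map_injective _ h) (fun t ht => ?_) (by simp)
  refine ⟨t.map σ.symm.toEmbedding, by simpa [Finset.mem_powersetCard] using ht, ?_⟩
  ext
  simp

theorem esymmOn_mul_esymmOn_le_sq (s : Finset ι) (k : ℕ) (x : ι → ℝ) :
    esymmOn s k x * esymmOn s (k + 2) x ≤ esymmOn s (k + 1) x ^ 2 := by
  rcases lt_or_ge s.card (k + 2) with h | h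
  · rw [esymmOn, esymmOn, Finset.powersetCard_eq_empty.2 h]
    simpa using sq_nonneg _
  · obtain ⟨d, hd⟩ := Nat.exists_eq_add_of_le h
    have hs : (∏ i ∈ s, (Polynomial.X + Polynomial.C (x i))).Splits :=
      Polynomial.Splits.prod fun i _ => Polynomial.Splits.X_add_C (x i)
    have := hs.coeff_mul_coeff_le_sq d
    rw [Finset.prod_X_add_C_coeff _ _ (by omega), Finset.prod_X_add_C_coeff _ _ (by omega),
      Finset.prod_X_add_C_coeff _ _ (by omega), show s.card - d = k + 2 by omega,
      show s.card - (d + 2) = k by omega, show s.card - (d + 1) = k + 1 by omega] at this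
    rwa [mul_comm]

/-- The Gårding cone of vectors: the first `k` elementary symmetric functions are positive. -/
def vectorGardingCone (s : Finset ι) (k : ℕ) : Set (ι → ℝ) :=
  {x | ∀ p ≤ k, 0 < esymmOn s p x}

theorem vectorGardingCone_anti (s : Finset ι) {k l : ℕ} (h : k ≤ l) :
    vectorGardingCone s l ⊆ vectorGardingCone s k :=
  fun _ hx p hp => hx p (hp.trans h)

theorem smul_mem_vectorGardingCone {s : Finset ι} {k : ℕ} {x : ι → ℝ}
    (hx : x ∈ vectorGardingCone s k) {c : ℝ} (hc : 0 < c) : c • x ∈ vectorGardingCone s k := by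
  intro p hp
  rw [esymmOn_smul]
  exact mul_pos (pow_pos hc p) (hx p hp)

variable [DecidableEq ι]

theorem esymmOn_insert_succ {s : Finset ι} {i : ι} (hi : i ∉ s) (k : ℕ) (x : ι → ℝ) :
    esymmOn (insert i s) (k + 1) x = x i * esymmOn s k x + esymmOn s (k + 1) x := by
  have hmem {t : Finset ι} {j : ℕ} (ht : t ∈ s.powersetCard j) : i ∉ t := fun h =>
    hi ((Finset.mem_powersetCard.1 ht).1 h)
  rw [esymmOn, Finset.powersetCard_succ_insert hi, Finset.sum_union, add_comm,
    Finset.sum_image, esymmOn, esymmOn, Finset.mul_sum]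
  · congr 1
    exact Finset.sum_congr rfl fun t ht => Finset.prod_insert (hmem ht)
  · intro t ht u hu h
    rw [← Finset.erase_insert (hmem ht), ← Finset.erase_insert (hmem hu)]
    exact congrArg (Finset.erase · i) h
  · rw [Finset.disjoint_left]
    intro t ht ht'
    obtain ⟨u, _, rfl⟩ := Finset.mem_image.1 ht'
    exact hmem ht (Finset.mem_insert_self _ _)

theorem esymmOn_succ_eq_erase {s : Finset ι} {i : ι} (hi : i ∈ s) (k : ℕ) (x : ι → ℝ) :
    esymmOn s (k + 1) x = x i * esymmOn (s.erase i) k x + esymmOn (s.erase i) (k + 1) x := by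
  conv_lhs => rw [← Finset.insert_erase hi]
  exact esymmOn_insert_succ (Finset.notMem_erase i s) k x

/-- Euler's identity for elementary symmetric functions. -/
theorem sum_mul_esymmOn_erase (s : Finset ι) (k : ℕ) (x : ι → ℝ) :
    ∑ i ∈ s, x i * esymmOn (s.erase i) k x = (k + 1) * esymmOn s (k + 1) x := by
  induction s using Finset.induction_on generalizing k with
  | empty =>
    rw [esymmOn, Finset.powersetCard_eq_empty.2 (by simp)]
    simp
  | insert a s ha ih =>
    rw [Finset.sum_insert ha, Finset.erase_insert ha, esymmOn_insert_succ ha]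
    have herase {i : ι} (hi : i ∈ s) : (insert a s).erase i = insert a (s.erase i) :=
      Finset.erase_insert_of_ne (fun h => ha (h ▸ hi))
    cases k with
    | zero => simp [esymmOn_one]
    | succ k =>
      have hsum : ∑ i ∈ s, x i * esymmOn ((insert a s).erase i) (k + 1) x =
          x a * ∑ i ∈ s, x i * esymmOn (s.erase i) k x +
            ∑ i ∈ s, x i * esymmOn (s.erase i) (k + 1) x := by
        rw [Finset.mul_sum, ← Finset.sum_add_distrib]
        refine Finset.sum_congr rfl fun i hi => ?_
        rw [herase hi, esymmOn_insert_succ fun h => ha (Finset.mem_of_mem_erase h)]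
        ring
      rw [hsum, ih, ih]
      push_cast
      ring

theorem vectorGardingCone_erase {s : Finset ι} {k : ℕ} {x : ι → ℝ}
    (hx : x ∈ vectorGardingCone s (k + 1)) {i : ι} (hi : i ∈ s) :
    x ∈ vectorGardingCone (s.erase i) k := by
  intro p
  induction p with
  | zero => simp
  | succ p ih =>
    intro hp
    have h₀ := ih (by omega)
    have h₁ := hx (p + 1) (by omega)
    have h₂ := hx (p + 2) (by omega)
    have hN := esymmOn_mul_esymmOn_le_sq (s.erase i) p x
    rw [esymmOn_succ_eq_erase hi] at h₁ h₂
    set a := esymmOn (s.erase i) p x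
    set b := esymmOn (s.erase i) (p + 1) x
    set c := esymmOn (s.erase i) (p + 2) x
    by_contra! hb
    have h₃ : 0 < a * (x i * b + c) := mul_pos h₀ h₂
    nlinarith [mul_nonneg_of_nonpos_of_nonpos hb (by linarith : -(x i * a + b) ≤ 0)]

theorem superadditive_mul_div_add {a b q r t : ℝ} (ha : 0 < a + q) (hb : 0 < b + r)
    (h : q + r ≤ t) :
    a * q / (a + q) + b * r / (b + r) ≤ (a + b) * t / (a + b + t) := by
  have ht : 0 < a + b + t := by linarith
  rw [div_add_div _ _ ha.ne' hb.ne', div_le_div_iff₀ (mul_pos ha hb) ht]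
  have hid : (a + b) * t * ((a + q) * (b + r)) - (a * q * (b + r) + (a + q) * (b * r)) * (a + b + t)
      = (a * r - b * q) ^ 2 + (t - q - r) * (a ^ 2 * (b + r) + b ^ 2 * (a + q)) := by
    ring
  have : 0 ≤ (t - q - r) * (a ^ 2 * (b + r) + b ^ 2 * (a + q)) :=
    mul_nonneg (by linarith) (by positivity)
  nlinarith [sq_nonneg (a * r - b * q)]

theorem succ_mul_esymmOn_div_eq_sum {s : Finset ι} {k : ℕ} {x : ι → ℝ}
    (hx : x ∈ vectorGardingCone s (k + 1)) :
    (k + 2) * (esymmOn s (k + 2) x / esymmOn s (k + 1) x) =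
      ∑ i ∈ s, x i * (esymmOn (s.erase i) (k + 1) x / esymmOn (s.erase i) k x) /
        (x i + esymmOn (s.erase i) (k + 1) x / esymmOn (s.erase i) k x) := by
  have h := sum_mul_esymmOn_erase s (k + 1) x
  rw [← mul_div_assoc, show ((k : ℝ) + 2) = ((k + 1 : ℕ) : ℝ) + 1 by push_cast; ring, ← h,
    Finset.sum_div]
  refine Finset.sum_congr rfl fun i hi => ?_
  have h₁ := (vectorGardingCone_erase hx hi k le_rfl).ne'
  have h₂ := (hx (k + 1) le_rfl).ne'
  rw [esymmOn_succ_eq_erase hi] at h₂ ⊢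
  have h₃ : x i + esymmOn (s.erase i) (k + 1) x / esymmOn (s.erase i) k x ≠ 0 := by
    rw [← mul_div_cancel_right₀ (x i) h₁, ← add_div]
    exact div_ne_zero h₂ h₁
  field_simp

/-- The cone `Γ_k` is closed under addition, and `σ_{k+1} / σ_k` is superadditive on it. -/
theorem vectorGardingCone_add_mem_and_div_superadditive (k : ℕ) (s : Finset ι) {x y : ι → ℝ}
    (hx : x ∈ vectorGardingCone s k) (hy : y ∈ vectorGardingCone s k) :
    x + y ∈ vectorGardingCone s k ∧
      esymmOn s (k + 1) x / esymmOn s k x + esymmOn s (k + 1) y / esymmOn s k y ≤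
        esymmOn s (k + 1) (x + y) / esymmOn s k (x + y) := by
  induction k generalizing s with
  | zero =>
    refine ⟨fun p hp => ?_, ?_⟩
    · obtain rfl : p = 0 := by omega
      simp
    · simp [esymmOn_one, Finset.sum_add_distrib]
  | succ k ih =>
    obtain ⟨hk, hq⟩ := ih s (vectorGardingCone_anti s k.le_succ hx)
      (vectorGardingCone_anti s k.le_succ hy)
    have hxy : x + y ∈ vectorGardingCone s (k + 1) := by
      intro p hp
      rcases hp.lt_or_eq with hp | rfl
      · exact hk p (by omega)
      · have := (add_pos (div_pos (hx _ le_rfl) (hx k k.le_succ))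
          (div_pos (hy _ le_rfl) (hy k k.le_succ))).trans_le hq
        exact (div_pos_iff_of_pos_right (hk k le_rfl)).1 this
    refine ⟨hxy, ?_⟩
    have hpos {z : ι → ℝ} (hz : z ∈ vectorGardingCone s (k + 1)) {i : ι} (hi : i ∈ s) :
        0 < z i + esymmOn (s.erase i) (k + 1) z / esymmOn (s.erase i) k z := by
      have h₁ := vectorGardingCone_erase hz hi k le_rfl
      have h₂ := hz (k + 1) le_rfl
      rw [esymmOn_succ_eq_erase hi] at h₂
      rw [← mul_div_cancel_right₀ (z i) h₁.ne', ← add_div]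
      exact div_pos h₂ h₁
    have hk2 : (0 : ℝ) < k + 2 := by positivity
    refine le_of_mul_le_mul_left ?_ hk2
    rw [mul_add, succ_mul_esymmOn_div_eq_sum hx, succ_mul_esymmOn_div_eq_sum hy,
      succ_mul_esymmOn_div_eq_sum hxy, ← Finset.sum_add_distrib]
    exact Finset.sum_le_sum fun i hi => superadditive_mul_div_add (hpos hx hi) (hpos hy hi)
      (ih (s.erase i) (vectorGardingCone_erase hx hi) (vectorGardingCone_erase hy hi)).2

theorem convex_vectorGardingCone (s : Finset ι) (k : ℕ) : Convex ℝ (vectorGardingCone s k) :=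
  convex_iff_forall_pos.2 fun _ hx _ hy _ _ ha hb _ =>
    (vectorGardingCone_add_mem_and_div_superadditive k s (smul_mem_vectorGardingCone hx ha)
      (smul_mem_vectorGardingCone hy hb)).1

theorem mulVec_mem_vectorGardingCone [Fintype ι] {k : ℕ} {D : Matrix ι ι ℝ}
    (hD : D ∈ doublyStochastic ℝ ι) {x : ι → ℝ} (hx : x ∈ vectorGardingCone Finset.univ k) :
    D *ᵥ x ∈ vectorGardingCone Finset.univ k := by
  obtain ⟨w, hw₀, hw₁, rfl⟩ := exists_eq_sum_perm_of_mem_doublyStochastic hD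
  rw [Matrix.sum_mulVec]
  simp only [Matrix.smul_mulVec, Matrix.permMatrix_mulVec]
  refine (convex_vectorGardingCone _ k).sum_mem (fun σ _ => hw₀ σ) hw₁ fun σ _ p hp => ?_
  rw [esymmOn_univ_comp_perm]
  exact hx p hp

end ElementarySymmetric

section PrincipalTraces

variable {ι : Type*} [Fintype ι]

theorem ptrace_smul (p : ℕ) (c : ℝ) (S : Matrix ι ι ℝ) :
    ptrace p (c • S) = c ^ p * ptrace p S := by
  classical
  rw [ptrace, ptrace, Finset.mul_sum]
  refine Finset.sum_congr rfl fun t ht => ?_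
  rw [Matrix.submatrix_smul, Pi.smul_apply, Pi.smul_apply, Matrix.det_smul, Fintype.card_coe,
    (Finset.mem_powersetCard.1 ht).2]

variable [DecidableEq ι]

theorem ptrace_diagonal (p : ℕ) (x : ι → ℝ) :
    ptrace p (Matrix.diagonal x) = esymmOn Finset.univ p x := by
  refine Finset.sum_congr (by congr!) fun t _ => ?_
  rw [Matrix.submatrix_diagonal _ _ Subtype.val_injective]
  refine Eq.trans ?_ (Finset.prod_coe_sort t x)
  convert Matrix.det_diagonal
  rfl

theorem ptrace_conj (p : ℕ) (U V S : Matrix ι ι ℝ) (hUV : V * U = 1) :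
    ptrace p (U * S * V) = ptrace p S := by
  have key (M : Matrix ι ι ℝ) (hp : p ≤ Fintype.card ι) :
      ptrace p M = (-1) ^ p * M.charpoly.coeff (Fintype.card ι - p) := by
    rw [Matrix.charpoly_coeff_eq_sum_minors M p hp, ← mul_assoc, ← mul_pow]
    simp only [mul_neg, mul_one, neg_neg, one_pow, one_mul]
    rw [ptrace]
    congr!
  rcases le_or_gt p (Fintype.card ι) with hp | hp
  · rw [key _ hp, key _ hp, Matrix.mul_assoc, Matrix.charpoly_mul_comm, Matrix.mul_assoc, hUV,
      Matrix.mul_one]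
  · rw [ptrace, ptrace, Finset.powersetCard_eq_empty.2 (by simpa using hp)]
    simp

theorem sq_entries_mem_doublyStochastic {U : Matrix ι ι ℝ} (hU : U ∈ Matrix.unitaryGroup ι ℝ) :
    (Matrix.of fun i j => U i j ^ 2) ∈ doublyStochastic ℝ ι := by
  rw [mem_doublyStochastic_iff_sum]
  refine ⟨fun i j => sq_nonneg _, fun i => ?_, fun j => ?_⟩
  · have := congrFun (congrFun (Matrix.mem_unitaryGroup_iff.1 hU) i) i
    simpa [Matrix.mul_apply, sq] using this
  · have := congrFun (congrFun (Matrix.mem_unitaryGroup_iff'.1 hU) j) j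
    simpa [Matrix.mul_apply, sq] using this

theorem Matrix.IsSymm.exists_orthogonal_diagonalization {S : Matrix ι ι ℝ} (hS : S.IsSymm) :
    ∃ U ∈ Matrix.unitaryGroup ι ℝ, ∃ x : ι → ℝ, S = U * Matrix.diagonal x * Uᵀ := by
  have hH : S.IsHermitian := by
    rw [Matrix.IsHermitian, Matrix.conjTranspose_eq_transpose_of_trivial]
    exact hS
  refine ⟨hH.eigenvectorUnitary, hH.eigenvectorUnitary.2, hH.eigenvalues, ?_⟩
  have := hH.spectral_theorem
  rwa [Unitary.conjStarAlgAut_apply, Matrix.star_eq_conjTranspose,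
    Matrix.conjTranspose_eq_transpose_of_trivial] at this

/-- The diagonal of an `m`-positive symmetric matrix lies in the vector Gårding cone. -/
theorem diag_mem_vectorGardingCone {m : ℕ} {S : Matrix ι ι ℝ} (hS : S.IsSymm)
    (hpos : ∀ p, 1 ≤ p → p ≤ m → 0 < ptrace p S) :
    S.diag ∈ vectorGardingCone Finset.univ m := by
  obtain ⟨U, hU, x, rfl⟩ := hS.exists_orthogonal_diagonalization
  have hUU : Uᵀ * U = 1 := by
    have := Matrix.mem_unitaryGroup_iff'.1 hU
    rwa [Matrix.star_eq_conjTranspose, Matrix.conjTranspose_eq_transpose_of_trivial] at this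
  have hx : x ∈ vectorGardingCone Finset.univ m := by
    intro p hp
    rcases Nat.eq_zero_or_pos p with rfl | h
    · simp
    · simpa only [ptrace_conj p U Uᵀ _ hUU, ptrace_diagonal] using hpos p h hp
  convert mulVec_mem_vectorGardingCone (sq_entries_mem_doublyStochastic hU) hx using 1
  ext i
  rw [Matrix.diag_apply, Matrix.mul_apply]
  simp only [Matrix.mul_diagonal, Matrix.transpose_apply, Matrix.mulVec, dotProduct,
    Matrix.of_apply]
  exact Finset.sum_congr rfl fun j _ => by ring

end PrincipalTraces

/-- For `1 ≤ m ≤ n`, the Gårding cone `K_m(n)` is a convex cone in the space of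
real symmetric `n × n` matrices: it is closed under multiplication by positive scalars and
under convex combinations. -/
theorem gardingCone_is_convex_cone (n m : ℕ) (h1 : 1 ≤ m) (h2 : m ≤ n) :
    (∀ S ∈ gardingCone n m, ∀ c : ℝ, 0 < c → c • S ∈ gardingCone n m) ∧
    Convex ℝ (gardingCone n m) := by
  have hsmul : ∀ S ∈ gardingCone n m, ∀ c : ℝ, 0 < c → c • S ∈ gardingCone n m := by
    rintro S ⟨hS, hpos⟩ c hc
    refine ⟨hS.smul c, fun p hp hpm => ?_⟩
    rw [ptrace_smul]
    exact mul_pos (pow_pos hc p) (hpos p hp hpm)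
  have hadd : ∀ A ∈ gardingCone n m, ∀ B ∈ gardingCone n m, A + B ∈ gardingCone n m := by
    rintro A ⟨hA, hApos⟩ B ⟨hB, hBpos⟩
    refine ⟨hA.add hB, fun p hp hpm => ?_⟩
    obtain ⟨U, hU, x, hx⟩ := (hA.add hB).exists_orthogonal_diagonalization
    have hUU : U * Uᵀ = 1 := by
      have := Matrix.mem_unitaryGroup_iff.1 hU
      rwa [Matrix.star_eq_conjTranspose, Matrix.conjTranspose_eq_transpose_of_trivial] at this
    have hUU' : Uᵀ * U = 1 := mul_eq_one_comm.1 hUU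
    have hdiag {S : Matrix (Fin n) (Fin n) ℝ} (hS : S.IsSymm)
        (hpos : ∀ p, 1 ≤ p → p ≤ m → 0 < ptrace p S) :
        (Uᵀ * S * U).diag ∈ vectorGardingCone Finset.univ m := by
      refine diag_mem_vectorGardingCone ?_ fun p h h' => ?_
      · rw [Matrix.IsSymm, Matrix.transpose_mul, Matrix.transpose_mul, hS.eq,
          Matrix.transpose_transpose, Matrix.mul_assoc]
      · rw [ptrace_conj p _ _ _ hUU]
        exact hpos p h h'
    have hxsum : x = (Uᵀ * A * U).diag + (Uᵀ * B * U).diag := by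
      rw [← Matrix.diag_add, ← Matrix.add_mul, ← Matrix.mul_add, hx, ← Matrix.mul_assoc,
        ← Matrix.mul_assoc, hUU', Matrix.one_mul, Matrix.mul_assoc, hUU', Matrix.mul_one,
        Matrix.diag_diagonal]
    rw [hx, ptrace_conj p _ _ _ hUU', ptrace_diagonal, hxsum]
    exact (vectorGardingCone_add_mem_and_div_superadditive m _ (hdiag hA hApos)
      (hdiag hB hBpos)).1 p hpm
  exact ⟨hsmul, convex_iff_forall_pos.2 fun A hA B hB a b ha hb _ =>
    hadd _ (hsmul A hA a ha) _ (hsmul B hB b hb)⟩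
end

section
/- For every 1 ≤ m ≤ n, the function F_m defined by F_m(S) = (T_m(S))^{1/m} is concave on the Gårding cone K_m(n). -/
open Matrix

open Polynomial

section MinorSum

variable {ι R S : Type*} [Fintype ι] [DecidableEq ι] [CommRing R] [CommRing S]

/-- The sum of the `k × k` principal minors of a square matrix. -/
def minorSum (k : ℕ) (M : Matrix ι ι R) : R :=
  ∑ t ∈ Finset.univ.powersetCard k, (M.submatrix (Subtype.val : t → ι) Subtype.val).det

theorem ptrace_eq_minorSum (k : ℕ) (M : Matrix ι ι ℝ) : ptrace k M = minorSum k M := by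
  simp only [ptrace, minorSum]
  congr!

theorem minorSum_map (f : R →+* S) (k : ℕ) (M : Matrix ι ι R) :
    minorSum k (M.map f) = f (minorSum k M) := by
  simp only [minorSum, map_sum, RingHom.map_det]
  rfl

theorem minorSum_smul (c : R) (k : ℕ) (M : Matrix ι ι R) :
    minorSum k (c • M) = c ^ k * minorSum k M := by
  simp only [minorSum, Finset.mul_sum]
  refine Finset.sum_congr rfl fun t ht => ?_
  rw [← (Finset.mem_powersetCard.mp ht).2, Matrix.submatrix_smul, Pi.smul_apply, Pi.smul_apply,
    det_smul, Fintype.card_coe]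

theorem minorSum_one (k : ℕ) : minorSum k (1 : Matrix ι ι R) = (Fintype.card ι).choose k := by
  simp [minorSum, Matrix.submatrix_one _ Subtype.val_injective]

theorem natDegree_minorSum_le (k : ℕ) (A B : Matrix ι ι R) :
    (minorSum k ((X : R[X]) • A.map C + B.map C)).natDegree ≤ k := by
  refine natDegree_sum_le_of_forall_le _ _ fun t ht => ?_
  have := natDegree_det_X_add_C_le (A.submatrix (Subtype.val : t → ι) Subtype.val)
    (B.submatrix Subtype.val Subtype.val)
  rwa [Fintype.card_coe, (Finset.mem_powersetCard.mp ht).2] at this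

theorem coeff_minorSum (k : ℕ) (A B : Matrix ι ι R) :
    (minorSum k ((X : R[X]) • A.map C + B.map C)).coeff k = minorSum k A := by
  simp only [minorSum, finsetSum_coeff]
  refine Finset.sum_congr rfl fun t ht => ?_
  have := coeff_det_X_add_C_card (A.submatrix (Subtype.val : t → ι) Subtype.val)
    (B.submatrix Subtype.val Subtype.val)
  rwa [Fintype.card_coe, (Finset.mem_powersetCard.mp ht).2] at this

theorem eval_minorSum (k : ℕ) (A B : Matrix ι ι R) (r : R) :
    (minorSum k ((X : R[X]) • A.map C + B.map C)).eval r = minorSum k (r • A + B) := by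
  rw [← coe_evalRingHom, ← minorSum_map]
  congr 1
  ext i j
  simp
  ring

theorem coeff_charpoly_neg {k : ℕ} (hk : k ≤ Fintype.card ι) (M : Matrix ι ι R) :
    (-M).charpoly.coeff (Fintype.card ι - k) = minorSum k M := by
  have := Matrix.charpoly_coeff_eq_sum_minors (-M) k hk
  rw [this, ← minorSum, ← neg_one_smul R M, minorSum_smul, ← mul_assoc, ← mul_pow]
  simp

theorem minorSum_add_smul_one {k : ℕ} (hk : k ≤ Fintype.card ι) (M : Matrix ι ι R) (z : R) :
    minorSum k (M + z • 1) = (hasseDeriv (Fintype.card ι - k) (-M).charpoly).eval z := by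
  rw [← coeff_charpoly_neg hk, ← taylor_coeff, taylor_apply, ← Matrix.charpoly_sub_scalar, neg_add,
    ← sub_eq_add_neg, smul_one_eq_diagonal, scalar_apply]

end MinorSum

section Hasse

theorem eval_derivative_ne_zero_of_im_ne_zero {f : ℂ[X]} (hf : 0 < f.degree)
    (h : ∀ z : ℂ, z.im ≠ 0 → f.eval z ≠ 0) (z : ℂ) (hz : z.im ≠ 0) :
    f.derivative.eval z ≠ 0 := by
  intro h0
  have hne : f.derivative ≠ 0 := by
    rw [Ne, derivative_eq_zero]
    rintro h1
    exact absurd (natDegree_pos_iff_degree_pos.mpr hf) (by simp [h1])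
  have := rootSet_derivative_subset_convexHull_rootSet hf
    (show z ∈ f.derivative.rootSet ℂ by simp [mem_rootSet, hne, h0])
  have hconv : Convex ℝ {w : ℂ | w.im = 0} := by
    have := (convex_singleton (0 : ℝ)).linear_preimage Complex.imLm
    exact this
  refine hz (convexHull_min (fun w hw => ?_) hconv this)
  by_contra hw'
  exact h w hw' (by simpa using (mem_rootSet.mp hw).2)

theorem eval_iterate_derivative_ne_zero_of_im_ne_zero {f : ℂ[X]} {j : ℕ} (hj : j ≤ f.natDegree)
    (hf0 : f ≠ 0) (h : ∀ z : ℂ, z.im ≠ 0 → f.eval z ≠ 0) (z : ℂ) (hz : z.im ≠ 0) :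
    (derivative^[j] f).eval z ≠ 0 := by
  induction j generalizing z with
  | zero => exact h z hz
  | succ j ih =>
    rw [Function.iterate_succ_apply']
    refine eval_derivative_ne_zero_of_im_ne_zero ?_ (fun w hw => ih (by omega) w hw) z hz
    rw [← natDegree_pos_iff_degree_pos]
    have hc : (derivative^[j] f).coeff (f.natDegree - j) ≠ 0 := by
      rw [coeff_iterate_derivative, Nat.sub_add_cancel (by omega)]
      simp [hf0, Nat.descFactorial_eq_zero_iff_lt]
      omega
    have := le_natDegree_of_ne_zero hc
    omega

theorem eval_hasseDeriv_ne_zero_of_im_ne_zero {f : ℂ[X]} {j : ℕ} (hj : j ≤ f.natDegree)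
    (hf0 : f ≠ 0) (h : ∀ z : ℂ, z.im ≠ 0 → f.eval z ≠ 0) (z : ℂ) (hz : z.im ≠ 0) :
    (hasseDeriv j f).eval z ≠ 0 := by
  intro h0
  apply eval_iterate_derivative_ne_zero_of_im_ne_zero hj hf0 h z hz
  have := congrArg (fun g : ℂ[X] → ℂ[X] => (g f).eval z) (factorial_smul_hasseDeriv (R := ℂ) j)
  rw [← this]
  simp [h0]

end Hasse

section HalfPlane

theorem norm_leadingCoeff_mul_re_pow_le {q : ℂ[X]} (hq : ∀ z : ℂ, 0 ≤ z.re → q.eval z ≠ 0)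
    {z : ℂ} (hz : 0 ≤ z.re) : ‖q.leadingCoeff‖ * z.re ^ q.natDegree ≤ ‖q.eval z‖ := by
  have hs := IsAlgClosed.splits q
  have hle : (q.roots.map fun _ => z.re).prod ≤ (q.roots.map fun r => ‖z - r‖).prod := by
    refine Multiset.prod_map_le_prod_map₀ _ _ (fun _ _ => hz) fun r hr => ?_
    have hr' : r.re < 0 := by
      by_contra! hr0
      exact hq r hr0 (isRoot_of_mem_roots hr)
    have := Complex.re_le_norm (z - r)
    rw [Complex.sub_re] at this
    linarith
  rw [Multiset.map_const', Multiset.prod_replicate, ← hs.natDegree_eq_card_roots] at hle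
  rw [hs.eval_eq_prod_roots, norm_mul]
  have hprod : ‖(q.roots.map (z - ·)).prod‖ = (q.roots.map fun r => ‖z - r‖).prod := by
    simpa using map_multiset_prod (normHom : ℂ →*₀ ℝ) (q.roots.map (z - ·))
  rw [hprod]
  gcongr

theorem continuous_eval_map_evalRingHom (P : ℂ[X][X]) :
    Continuous fun p : ℝ × ℂ => (P.map (evalRingHom (p.1 : ℂ))).eval p.2 := by
  have h : ∀ p : ℝ × ℂ, (P.map (evalRingHom (p.1 : ℂ))).eval p.2 =
      ∑ i ∈ Finset.range (P.natDegree + 1), (P.coeff i).eval (p.1 : ℂ) * p.2 ^ i := fun p => by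
    rw [eval_eq_sum_range' (Nat.lt_succ_of_le natDegree_map_le)]
    simp
  simp only [h]
  fun_prop

/-- Zeros of a one-parameter family of polynomials of constant degree cannot leave the open left
half-plane without crossing the imaginary axis. -/
theorem eval_map_ne_zero_of_homotopy {P : ℂ[X][X]} {m : ℕ} {c : ℂ} (hc : c ≠ 0)
    (hd : P.natDegree ≤ m) (hm : P.coeff m = C c)
    (h0 : ∀ z : ℂ, 0 ≤ z.re → (P.map (evalRingHom 0)).eval z ≠ 0)
    (hb : ∀ s : ℝ, s ∈ Set.Icc (0 : ℝ) 1 → ∀ z : ℂ, z.re = 0 →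
      (P.map (evalRingHom (s : ℂ))).eval z ≠ 0)
    (z : ℂ) (hz : 0 ≤ z.re) : (P.map (evalRingHom 1)).eval z ≠ 0 := by
  set q : ℝ → ℂ[X] := fun s => P.map (evalRingHom (s : ℂ)) with hq
  have hcont : Continuous fun p : ℝ × ℂ => (q p.1).eval p.2 := continuous_eval_map_evalRingHom P
  have hcoeff : ∀ s, (q s).coeff m = c := fun s => by simp [hq, hm]
  have hdeg : ∀ s, (q s).natDegree = m := fun s =>
    natDegree_eq_of_le_of_coeff_ne_zero (natDegree_map_le.trans hd) (by rwa [hcoeff])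
  have hlead : ∀ s, (q s).leadingCoeff = c := fun s => by rw [leadingCoeff, hdeg, hcoeff]
  have hcauchy : Continuous fun s => cauchyBound (q s) := by
    simp only [cauchyBound, hdeg, hlead]
    refine Continuous.add (Continuous.div_const (Continuous.finset_sup_apply fun i _ => ?_) _)
      continuous_const
    simp only [hq, coeff_map, coe_evalRingHom]
    fun_prop
  obtain ⟨b, hbound⟩ := isCompact_Icc.bddAbove_image (K := Set.Icc (0 : ℝ) 1) hcauchy.continuousOn
  let good : Set ℝ := {s | ∀ z : ℂ, 0 ≤ z.re → (q s).eval z ≠ 0}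
  have hclosed : IsClosed (good ∩ Set.Icc 0 1) := by
    have : good ∩ Set.Icc 0 1 =
        (⋂ z : ℂ, ⋂ _ : 0 < z.re, {s : ℝ | ‖c‖ * z.re ^ m ≤ ‖(q s).eval z‖}) ∩ Set.Icc 0 1 := by
      ext s
      simp only [Set.mem_inter_iff, Set.mem_iInter, Set.mem_ofPred_eq]
      refine and_congr_left fun hs => ⟨fun hg w hw => ?_, fun hg w hw => ?_⟩
      · have := norm_leadingCoeff_mul_re_pow_le hg hw.le
        rwa [hlead, hdeg] at this
      · rcases hw.eq_or_lt with hw | hw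
        · exact hb s hs w hw.symm
        · rw [← norm_pos_iff]
          exact lt_of_lt_of_le (by positivity) (hg w hw)
    rw [this]
    refine IsClosed.inter (isClosed_iInter fun w => isClosed_iInter fun _ => ?_) isClosed_Icc
    exact isClosed_le continuous_const
      (hcont.comp (continuous_id.prodMk continuous_const)).norm
  let bad : Set ℝ := Prod.fst '' ((Set.Icc (0 : ℝ) 1 ×ˢ Metric.closedBall (0 : ℂ) b) ∩
    {p : ℝ × ℂ | 0 ≤ p.2.re ∧ (q p.1).eval p.2 = 0})
  have hbad : IsClosed bad := by
    refine (IsCompact.image (IsCompact.inter_right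
      (isCompact_Icc.prod (isCompact_closedBall _ _)) ?_) continuous_fst).isClosed
    exact (isClosed_le continuous_const (Complex.continuous_re.comp continuous_snd)).inter
      (isClosed_eq hcont continuous_const)
  have hgood : ∀ s ∈ Set.Icc (0 : ℝ) 1, s ∉ bad → s ∈ good := by
    intro s hs hsb w hw hroot
    refine hsb ⟨(s, w), ⟨⟨hs, ?_⟩, hw, hroot⟩, rfl⟩
    have hne : q s ≠ 0 := by rw [← leadingCoeff_ne_zero, hlead]; exact hc
    have h1 : ‖w‖₊ < cauchyBound (q s) := IsRoot.norm_lt_cauchyBound hne hroot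
    have h2 : cauchyBound (q s) ≤ b := hbound ⟨s, hs, rfl⟩
    rw [mem_closedBall_zero_iff]
    exact_mod_cast h1.le.trans h2
  have hsub : Set.Icc 0 1 ⊆ good := by
    refine hclosed.Icc_subset_of_forall_mem_nhdsWithin (by simpa [good, hq] using h0) ?_
    rintro s ⟨hs, hs0, hs1⟩
    have hsb : s ∉ bad := by
      rintro ⟨⟨s', w⟩, ⟨-, hw, hroot⟩, rfl⟩
      exact hs w hw hroot
    filter_upwards [mem_nhdsWithin_of_mem_nhds (hbad.isOpen_compl.mem_nhds hsb),
      mem_nhdsWithin_of_mem_nhds (Iio_mem_nhds hs1), self_mem_nhdsWithin] with u hu hu1 hus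
    exact hgood u ⟨hs0.trans (le_of_lt hus), le_of_lt hu1⟩ hu
  have := hsub (Set.right_mem_Icc.mpr zero_le_one) z hz
  simpa [hq] using this

end HalfPlane

section Complexify

variable {ι : Type*}

/-- A real matrix, viewed as a complex one. -/
def complexify (A : Matrix ι ι ℝ) : Matrix ι ι ℂ := A.map Complex.ofRealHom

theorem complexify_add (A B : Matrix ι ι ℝ) :
    complexify (A + B) = complexify A + complexify B := by
  ext; simp [complexify]

theorem complexify_neg (A : Matrix ι ι ℝ) : complexify (-A) = -complexify A := by
  ext; simp [complexify]

theorem complexify_smul (r : ℝ) (A : Matrix ι ι ℝ) :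
    complexify (r • A) = (r : ℂ) • complexify A := by
  ext; simp [complexify]

theorem complexify_one [DecidableEq ι] : complexify (1 : Matrix ι ι ℝ) = 1 :=
  Matrix.map_one _ (map_zero _) (map_one _)

variable [Fintype ι] [DecidableEq ι]

theorem minorSum_complexify (k : ℕ) (A : Matrix ι ι ℝ) :
    minorSum k (complexify A) = (minorSum k A : ℝ) :=
  minorSum_map Complex.ofRealHom k A

theorem minorSum_homotopy {k : ℕ} {A M₀ M₁ : Matrix ι ι ℂ} (hA : minorSum k A ≠ 0)
    (h0 : ∀ z : ℂ, 0 ≤ z.re → minorSum k (z • A + M₀) ≠ 0)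
    (hb : ∀ s : ℝ, s ∈ Set.Icc (0 : ℝ) 1 → ∀ z : ℂ, z.re = 0 →
      minorSum k (z • A + (M₀ + (s : ℂ) • M₁)) ≠ 0)
    (z : ℂ) (hz : 0 ≤ z.re) : minorSum k (z • A + (M₀ + M₁)) ≠ 0 := by
  set P : ℂ[X][X] := minorSum k
    ((X : ℂ[X][X]) • (A.map C).map C + (M₀.map C + (X : ℂ[X]) • M₁.map C).map C) with hP
  have heval : ∀ s z : ℂ, (P.map (evalRingHom s)).eval z = minorSum k (z • A + (M₀ + s • M₁)) := by
    intro s z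
    change ((evalRingHom z).comp (mapRingHom (evalRingHom s))) P = _
    rw [hP, ← minorSum_map]
    congr 1
    ext i j
    simp
    ring
  have hcoeff : P.coeff k = C (minorSum k A) := by
    rw [hP, coeff_minorSum, minorSum_map]
  have := eval_map_ne_zero_of_homotopy hA (natDegree_minorSum_le k _ _) hcoeff
    (fun z hz => by rw [heval]; simpa using h0 z hz)
    (fun s hs z hz => by rw [heval]; exact hb s hs z hz) z hz
  rw [heval, one_smul] at this
  exact this

theorem norm_minorSum_mul_re_pow_le {k : ℕ} {A B : Matrix ι ι ℂ} (hA : minorSum k A ≠ 0)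
    (h : ∀ z : ℂ, 0 ≤ z.re → minorSum k (z • A + B) ≠ 0) {z : ℂ} (hz : 0 ≤ z.re) :
    ‖minorSum k A‖ * z.re ^ k ≤ ‖minorSum k (z • A + B)‖ := by
  set q : ℂ[X] := minorSum k ((X : ℂ[X]) • A.map C + B.map C)
  have heval : ∀ z, q.eval z = minorSum k (z • A + B) := eval_minorSum k A B
  have hcoeff : q.coeff k = minorSum k A := coeff_minorSum k A B
  have hdeg : q.natDegree = k :=
    natDegree_eq_of_le_of_coeff_ne_zero (natDegree_minorSum_le k A B) (by rwa [hcoeff])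
  have := norm_leadingCoeff_mul_re_pow_le (q := q) (fun z hz => by rw [heval]; exact h z hz) hz
  rwa [leadingCoeff, hdeg, hcoeff, heval] at this

theorem charpoly_complexify_eval_ne_zero {A : Matrix ι ι ℝ} (hA : A.IsSymm) {z : ℂ}
    (hz : z.im ≠ 0) : (complexify A).charpoly.eval z ≠ 0 := by
  have hH : (complexify A).IsHermitian := by
    ext i j
    simp [complexify, hA.apply]
  rw [hH.charpoly_eq, eval_prod, Finset.prod_ne_zero_iff]
  intro i _ h
  apply hz
  have h' : z = (hH.eigenvalues i : ℂ) := by simpa [sub_eq_zero] using h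
  simp [h']

theorem minorSum_complexify_add_smul_one_ne_zero {k : ℕ} (hk : k ≤ Fintype.card ι)
    {A : Matrix ι ι ℝ} (hA : A.IsSymm) {z : ℂ} (hz : z.im ≠ 0) :
    minorSum k (complexify A + z • 1) ≠ 0 := by
  rw [minorSum_add_smul_one hk, ← complexify_neg]
  refine eval_hasseDeriv_ne_zero_of_im_ne_zero ?_ (charpoly_monic _).ne_zero
    (fun w hw => charpoly_complexify_eval_ne_zero hA.neg hw) z hz
  rw [charpoly_natDegree_eq_dim]
  exact Nat.sub_le _ _

theorem minorSum_smul_one_add_I_smul_ne_zero {k : ℕ} (hk : k ≤ Fintype.card ι)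
    {A : Matrix ι ι ℝ} (hA : A.IsSymm) {r : ℝ} (hr : r ≠ 0) :
    minorSum k ((r : ℂ) • 1 + Complex.I • complexify A) ≠ 0 := by
  have : (r : ℂ) • (1 : Matrix ι ι ℂ) + Complex.I • complexify A =
      Complex.I • (complexify A + (-(Complex.I * r)) • 1) := by
    rw [smul_add, smul_smul, add_comm, mul_neg, ← mul_assoc, Complex.I_mul_I]
    simp
  rw [this, minorSum_smul]
  exact mul_ne_zero (pow_ne_zero _ Complex.I_ne_zero)
    (minorSum_complexify_add_smul_one_ne_zero hk hA (by simpa using hr))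

theorem minorSum_add_smul_one_pos {k : ℕ} (hk : k ≤ Fintype.card ι) {A : Matrix ι ι ℝ}
    (hA : ∀ p ≤ k, 0 < minorSum p A) {r : ℝ} (hr : 0 ≤ r) : 0 < minorSum k (A + r • 1) := by
  have hcoeff : ∀ i ≤ k, 0 < (hasseDeriv (Fintype.card ι - k) (-A).charpoly).coeff i := by
    intro i hi
    rw [hasseDeriv_coeff, show i + (Fintype.card ι - k) = Fintype.card ι - (k - i) by omega,
      coeff_charpoly_neg (by omega)]
    have := hA (k - i) (by omega)
    have : 0 < (Fintype.card ι - (k - i)).choose (Fintype.card ι - k) :=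
      Nat.choose_pos (by omega)
    positivity
  have hdeg : (hasseDeriv (Fintype.card ι - k) (-A).charpoly).natDegree ≤ k := by
    refine (natDegree_hasseDeriv_le _ _).trans ?_
    rw [charpoly_natDegree_eq_dim]
    omega
  rw [minorSum_add_smul_one hk, eval_eq_sum_range' (Nat.lt_succ_of_le hdeg)]
  refine Finset.sum_pos' (fun i hi => ?_) ⟨0, by simp, by simpa using hcoeff 0 (Nat.zero_le _)⟩
  have := hcoeff i (by simpa [Nat.lt_succ_iff] using hi)
  positivity

/-- A symmetric matrix, `p`-positive for all `p ≤ k`. -/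
structure IsKPositive (k : ℕ) (A : Matrix ι ι ℝ) : Prop where
  symm : A.IsSymm
  pos : ∀ p ≤ k, 0 < minorSum p A

namespace IsKPositive

variable {k : ℕ} {A B : Matrix ι ι ℝ}

theorem minorSum_ne_zero (hA : IsKPositive k A) : minorSum k (complexify A) ≠ 0 := by
  rw [minorSum_complexify]
  exact_mod_cast (hA.pos k le_rfl).ne'

theorem add_smul_one_ne_zero (hk : k ≤ Fintype.card ι) (hA : IsKPositive k A) {z : ℂ}
    (hz : 0 ≤ z.re) : minorSum k (complexify A + z • 1) ≠ 0 := by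
  by_cases him : z.im = 0
  · have hzr : z = (z.re : ℂ) := Complex.ext rfl (by simpa using him)
    rw [hzr, ← complexify_one, ← complexify_smul, ← complexify_add, minorSum_complexify]
    exact_mod_cast (minorSum_add_smul_one_pos hk hA.pos hz).ne'
  · exact minorSum_complexify_add_smul_one_ne_zero hk hA.symm him

theorem smul_add_smul_one_ne_zero (hk : k ≤ Fintype.card ι) (hA : IsKPositive k A) {r : ℝ}
    (hr : 0 < r) {z : ℂ} (hz : 0 ≤ z.re) :
    minorSum k (z • complexify A + (r : ℂ) • 1) ≠ 0 := by
  have hr' : (r : ℂ) ≠ 0 := by exact_mod_cast hr.ne'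
  by_cases h0 : z = 0
  · rw [h0, zero_smul, zero_add, minorSum_smul, minorSum_one]
    exact mul_ne_zero (pow_ne_zero _ hr') (by exact_mod_cast (Nat.choose_pos hk).ne')
  · have : z • complexify A + (r : ℂ) • 1 = z • (complexify A + ((r : ℂ) / z) • 1) := by
      rw [smul_add, smul_smul, mul_div_cancel₀ _ h0]
    rw [this, minorSum_smul]
    refine mul_ne_zero (pow_ne_zero _ h0) (hA.add_smul_one_ne_zero hk ?_)
    rw [Complex.div_re]
    simp only [Complex.ofReal_re, Complex.ofReal_im, zero_mul, zero_div, add_zero]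
    have := Complex.normSq_nonneg z
    positivity

theorem smul_add_smul_one_add_I_smul_ne_zero (hk : k ≤ Fintype.card ι) (hA : IsKPositive k A)
    (hB : B.IsSymm) {r : ℝ} (hr : 0 < r) {z : ℂ} (hz : 0 ≤ z.re) :
    minorSum k (z • complexify A + ((r : ℂ) • 1 + Complex.I • complexify B)) ≠ 0 := by
  refine minorSum_homotopy hA.minorSum_ne_zero
    (fun w hw => hA.smul_add_smul_one_ne_zero hk hr hw) (fun s _ w hw => ?_) z hz
  have hwI : w = Complex.I * (w.im : ℂ) := Complex.ext (by simpa using hw) (by simp)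
  have : w • complexify A + ((r : ℂ) • 1 + (s : ℂ) • Complex.I • complexify B) =
      (r : ℂ) • 1 + Complex.I • complexify (w.im • A + s • B) := by
    rw [complexify_add, complexify_smul, complexify_smul, smul_add, smul_smul Complex.I, ← hwI,
      smul_comm Complex.I (s : ℂ)]
    abel
  rw [this]
  exact minorSum_smul_one_add_I_smul_ne_zero hk ((hA.symm.smul _).add (hB.smul _)) hr.ne'

theorem smul_add_I_smul_ne_zero (hk : k ≤ Fintype.card ι) (hA : IsKPositive k A)
    (hB : B.IsSymm) {z : ℂ} (hz : z.re ≠ 0) :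
    minorSum k (z • complexify A + Complex.I • complexify B) ≠ 0 := by
  wlog hpos : 0 < z.re generalizing z B
  · have h := this hB.neg (z := -z) (by simpa using hz)
      (by rw [Complex.neg_re]; exact neg_pos.mpr (lt_of_le_of_ne (not_lt.mp hpos) hz))
    rw [show (-z) • complexify A + Complex.I • complexify (-B) =
      (-1 : ℂ) • (z • complexify A + Complex.I • complexify B) by
        rw [complexify_neg]; simp, minorSum_smul] at h
    exact right_ne_zero_of_mul h
  have hbound : ∀ r : ℝ, 0 < r → ‖minorSum k (complexify A)‖ * z.re ^ k ≤
      ‖minorSum k ((z • complexify A + Complex.I • complexify B) + (r : ℂ) • 1)‖ := by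
    intro r hr
    have := norm_minorSum_mul_re_pow_le hA.minorSum_ne_zero
      (fun w hw => hA.smul_add_smul_one_add_I_smul_ne_zero hk hB hr hw) hpos.le
    rwa [add_assoc, add_comm (Complex.I • _)]
  have hcont : Continuous fun r : ℝ =>
      ‖minorSum k ((z • complexify A + Complex.I • complexify B) + (r : ℂ) • 1)‖ := by
    simp only [minorSum_add_smul_one hk]
    fun_prop
  have hlim := ge_of_tendsto ((hcont.tendsto 0).mono_left (nhdsWithin_le_nhds (s := Set.Ioi 0)))
    (by filter_upwards [self_mem_nhdsWithin] with r hr using hbound r hr)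
  rw [Complex.ofReal_zero, zero_smul, add_zero] at hlim
  rw [← norm_pos_iff]
  have := norm_pos_iff.mpr hA.minorSum_ne_zero
  exact lt_of_lt_of_le (by positivity) hlim

theorem smul_add_ne_zero_of_im_ne_zero (hk : k ≤ Fintype.card ι) (hA : IsKPositive k A)
    (hB : B.IsSymm) {z : ℂ} (hz : z.im ≠ 0) :
    minorSum k (z • complexify A + complexify B) ≠ 0 := by
  have h := hA.smul_add_I_smul_ne_zero hk hB (z := Complex.I * z) (by simpa using hz)
  rw [mul_smul, ← smul_add, minorSum_smul] at h
  exact right_ne_zero_of_mul h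

theorem smul_add_ne_zero_of_re_nonneg (hk : k ≤ Fintype.card ι) (hA : IsKPositive k A)
    (hB : IsKPositive k B) {z : ℂ} (hz : 0 ≤ z.re) :
    minorSum k (z • complexify A + complexify B) ≠ 0 := by
  have key := minorSum_homotopy (M₀ := 1) (M₁ := complexify B - 1) hA.minorSum_ne_zero
    (fun w hw => by simpa using hA.smul_add_smul_one_ne_zero hk one_pos hw)
    (fun s hs w hw => ?_) z hz
  · rwa [add_sub_cancel] at key
  have hs' : (1 : Matrix ι ι ℂ) + (s : ℂ) • (complexify B - 1) =
      complexify (s • B + (1 - s) • 1) := by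
    rw [complexify_add, complexify_smul, complexify_smul, complexify_one]
    push_cast
    module
  rw [hs']
  by_cases h0 : w.im = 0
  · rw [show w = 0 from Complex.ext hw h0, zero_smul, zero_add, ← hs']
    rcases hs.1.eq_or_lt with h | h
    · rw [← h, Complex.ofReal_zero, zero_smul, add_zero, minorSum_one]
      exact_mod_cast (Nat.choose_pos hk).ne'
    · have hne : (s : ℂ) ≠ 0 := by exact_mod_cast h.ne'
      rw [show (1 : Matrix ι ι ℂ) + (s : ℂ) • (complexify B - 1) =
        (s : ℂ) • (complexify B + (((1 - s) / s : ℝ) : ℂ) • 1) by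
          push_cast
          rw [smul_add, smul_smul, mul_div_cancel₀ _ hne]
          module, minorSum_smul]
      refine mul_ne_zero (pow_ne_zero _ hne) (hB.add_smul_one_ne_zero hk ?_)
      rw [Complex.ofReal_re]
      exact div_nonneg (sub_nonneg.mpr hs.2) hs.1
  · exact hA.smul_add_ne_zero_of_im_ne_zero hk ((hB.symm.smul _).add (isSymm_one.smul _)) h0

/-- `minorSum k (t • A + B)` is a polynomial in `t` with leading coefficient `minorSum k A` and
only real negative roots. -/
theorem exists_roots (hk : k ≤ Fintype.card ι) (hA : IsKPositive k A) (hB : IsKPositive k B) :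
    ∃ s : Multiset ℝ, s.card = k ∧ (∀ x ∈ s, 0 < x) ∧
      ∀ t : ℝ, minorSum k (t • A + B) = minorSum k A * (s.map (t + ·)).prod := by
  set q : ℂ[X] := minorSum k ((X : ℂ[X]) • (complexify A).map C + (complexify B).map C)
  have heval : ∀ z, q.eval z = minorSum k (z • complexify A + complexify B) := eval_minorSum k _ _
  have hcoeff : q.coeff k = minorSum k (complexify A) := coeff_minorSum k _ _
  have hdeg : q.natDegree = k := natDegree_eq_of_le_of_coeff_ne_zero
    (natDegree_minorSum_le k _ _) (by rw [hcoeff]; exact hA.minorSum_ne_zero)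
  have hs := IsAlgClosed.splits q
  have hroot : ∀ r ∈ q.roots, r.im = 0 ∧ r.re < 0 := by
    intro r hr
    have h0 : q.eval r = 0 := isRoot_of_mem_roots hr
    rw [heval] at h0
    constructor
    · by_contra h
      exact hA.smul_add_ne_zero_of_im_ne_zero hk hB.symm h h0
    · by_contra! h
      exact hA.smul_add_ne_zero_of_re_nonneg hk hB h h0
  refine ⟨q.roots.map fun r => -r.re, ?_, ?_, fun t => ?_⟩
  · rw [Multiset.card_map, ← hs.natDegree_eq_card_roots, hdeg]
  · simp only [Multiset.mem_map]
    rintro x ⟨r, hr, rfl⟩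
    exact neg_pos.mpr (hroot r hr).2
  · have h := hs.eval_eq_prod_roots (t : ℂ)
    rw [heval, leadingCoeff, hdeg, hcoeff, ← complexify_smul, ← complexify_add,
      minorSum_complexify, minorSum_complexify] at h
    have hprod : (q.roots.map ((t : ℂ) - ·)).prod =
        (((q.roots.map fun r => -r.re).map (t + ·)).prod : ℝ) := by
      change _ = Complex.ofRealHom _
      rw [map_multiset_prod, Multiset.map_map, Multiset.map_map]
      congr 1
      refine Multiset.map_congr rfl fun r hr => Complex.ext ?_ ?_
      · simp [sub_eq_add_neg]
      · simp [(hroot r hr).1]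
    rw [hprod] at h
    exact_mod_cast h

end IsKPositive

end Complexify

theorem one_add_prod_rpow_le {s : Multiset ℝ} (hs : ∀ x ∈ s, 0 < x) (hcard : 0 < s.card) :
    1 + s.prod ^ ((1 : ℝ) / s.card) ≤ (s.map (1 + ·)).prod ^ ((1 : ℝ) / s.card) := by
  obtain ⟨k, f, rfl⟩ : ∃ (k : ℕ) (f : Fin k → ℝ), s = Finset.univ.val.map f := by
    refine ⟨s.toList.length, s.toList.get, ?_⟩
    rw [Fin.univ_val_map, List.ofFn_get, Multiset.coe_toList]
  have hf : ∀ i, 0 < f i := fun i => hs _ (Multiset.mem_map_of_mem f (Finset.mem_univ_val i))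
  simp only [Multiset.card_map, Finset.card_val, Finset.card_univ, Fintype.card_fin,
    Multiset.map_map, Function.comp_apply] at hcard ⊢
  change 1 + (∏ i, f i) ^ ((1 : ℝ) / k) ≤ (∏ i, (1 + f i)) ^ ((1 : ℝ) / k)
  have hk : (0 : ℝ) < k := by exact_mod_cast hcard
  have hf1 : ∀ i, 0 < 1 + f i := fun i => by linarith [hf i]
  have hP : 0 < ∏ i, (1 + f i) := Finset.prod_pos fun i _ => hf1 i
  have hsum : ∑ _i : Fin k, (1 : ℝ) / k = 1 := by
    rw [Finset.sum_const, Finset.card_univ, Fintype.card_fin, nsmul_eq_mul]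
    field_simp
  have amgm : ∀ g : Fin k → ℝ, (∀ i, 0 < g i) →
      (∏ i, g i) ^ ((1 : ℝ) / k) / (∏ i, (1 + f i)) ^ ((1 : ℝ) / k) ≤
        ∑ i, 1 / k * (g i / (1 + f i)) := by
    intro g hg
    have := Real.geom_mean_le_arith_mean_weighted Finset.univ (fun _ => (1 : ℝ) / k)
      (fun i => g i / (1 + f i)) (fun _ _ => by positivity) hsum
      (fun i _ => (div_pos (hg i) (hf1 i)).le)
    rw [Real.finsetProd_rpow _ _ fun i _ => (div_pos (hg i) (hf1 i)).le,
      Finset.prod_div_distrib, Real.div_rpow (Finset.prod_nonneg fun i _ => (hg i).le) hP.le]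
      at this
    exact this
  have h1 := amgm (fun _ => 1) fun _ => one_pos
  have h2 := amgm f hf
  have h3 : ∑ i, 1 / (k : ℝ) * (1 / (1 + f i)) + ∑ i, 1 / (k : ℝ) * (f i / (1 + f i)) = 1 := by
    refine Eq.trans ?_ hsum
    rw [← Finset.sum_add_distrib]
    refine Finset.sum_congr rfl fun i _ => ?_
    rw [← mul_add, ← add_div, div_self (hf1 i).ne', mul_one]
  rw [Finset.prod_const_one, Real.one_rpow] at h1
  have hpos := Real.rpow_pos_of_pos hP ((1 : ℝ) / k)
  have : (1 + (∏ i, f i) ^ ((1 : ℝ) / k)) / (∏ i, (1 + f i)) ^ ((1 : ℝ) / k) ≤ 1 := by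
    rw [add_div]
    linarith
  exact (div_le_one hpos).mp this

namespace IsKPositive

variable {ι : Type*} [Fintype ι] [DecidableEq ι] {k : ℕ} {A B : Matrix ι ι ℝ}

theorem mono {p : ℕ} (hp : p ≤ k) (hA : IsKPositive k A) : IsKPositive p A :=
  ⟨hA.symm, fun q hq => hA.pos q (hq.trans hp)⟩

theorem smul {c : ℝ} (hc : 0 < c) (hA : IsKPositive k A) : IsKPositive k (c • A) :=
  ⟨hA.symm.smul c, fun p hp => by
    rw [minorSum_smul]
    exact mul_pos (pow_pos hc p) (hA.pos p hp)⟩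

theorem add (hk : k ≤ Fintype.card ι) (hA : IsKPositive k A) (hB : IsKPositive k B) :
    IsKPositive k (A + B) := by
  refine ⟨hA.symm.add hB.symm, fun p hp => ?_⟩
  obtain ⟨s, -, hs, h⟩ := (hA.mono hp).exists_roots (hp.trans hk) (hB.mono hp)
  have h1 := h 1
  rw [one_smul] at h1
  rw [h1]
  refine mul_pos (hA.pos p hp) (Multiset.prod_pos fun x hx => ?_)
  obtain ⟨y, hy, rfl⟩ := Multiset.mem_map.mp hx
  linarith [hs y hy]

theorem minorSum_rpow_add_le (hk0 : 0 < k) (hk : k ≤ Fintype.card ι) (hA : IsKPositive k A)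
    (hB : IsKPositive k B) :
    minorSum k A ^ ((1 : ℝ) / k) + minorSum k B ^ ((1 : ℝ) / k) ≤
      minorSum k (A + B) ^ ((1 : ℝ) / k) := by
  obtain ⟨s, rfl, hs, h⟩ := hA.exists_roots hk hB
  have h1 := h 1
  have h0 := h 0
  rw [one_smul] at h1
  simp only [zero_smul, zero_add, Multiset.map_id'] at h0
  have hpos := hA.pos _ le_rfl
  rw [h0, h1, Real.mul_rpow hpos.le (Multiset.prod_nonneg fun x hx => (hs x hx).le),
    Real.mul_rpow hpos.le (Multiset.prod_nonneg fun x hx => ?_)]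
  · have := mul_le_mul_of_nonneg_left (one_add_prod_rpow_le hs hk0)
      (Real.rpow_nonneg hpos.le ((1 : ℝ) / s.card))
    linarith
  · obtain ⟨y, hy, rfl⟩ := Multiset.mem_map.mp hx
    linarith [hs y hy]

theorem smul_minorSum_rpow (hk0 : 0 < k) {c : ℝ} (hc : 0 < c) (hA : IsKPositive k A) :
    minorSum k (c • A) ^ ((1 : ℝ) / k) = c * minorSum k A ^ ((1 : ℝ) / k) := by
  rw [minorSum_smul, Real.mul_rpow (pow_pos hc k).le (hA.pos k le_rfl).le, one_div,
    Real.pow_rpow_inv_natCast hc.le hk0.ne']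

end IsKPositive

theorem mem_gardingCone_iff {n m : ℕ} {S : Matrix (Fin n) (Fin n) ℝ} :
    S ∈ gardingCone n m ↔ IsKPositive m S := by
  constructor
  · rintro ⟨hS, h⟩
    refine ⟨hS, fun p hp => ?_⟩
    rcases p.eq_zero_or_pos with rfl | hp0
    · simp [minorSum]
    · rw [← ptrace_eq_minorSum]
      exact h p hp0 hp
  · rintro ⟨hS, h⟩
    exact ⟨hS, fun p _ hp => by rw [ptrace_eq_minorSum]; exact h p hp⟩

/-- For `1 ≤ m ≤ n`, the function `F_m(S) = T_m(S)^(1/m)` is concave on the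
Gårding cone `K_m(n)`. -/
theorem Fm_concaveOn_gardingCone (n m : ℕ) (h1 : 1 ≤ m) (h2 : m ≤ n) :
    ConcaveOn ℝ (gardingCone n m) (fun S => (ptrace m S) ^ ((1 : ℝ) / m)) := by
  have hm : m ≤ Fintype.card (Fin n) := by rwa [Fintype.card_fin]
  rw [concaveOn_iff_forall_pos]
  refine ⟨convex_iff_forall_pos.mpr fun A hA B hB a b ha hb _ => ?_,
    fun A hA B hB a b ha hb _ => ?_⟩ <;> rw [mem_gardingCone_iff] at hA hB
  · exact mem_gardingCone_iff.mpr ((hA.smul ha).add hm (hB.smul hb))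
  · simp only [ptrace_eq_minorSum, smul_eq_mul]
    rw [← hA.smul_minorSum_rpow h1 ha, ← hB.smul_minorSum_rpow h1 hb]
    exact (hA.smul ha).minorSum_rpow_add_le h1 hm (hB.smul hb)
end

section
/- (Sylvester criterion for m-positive matrices, single-index form.) Let S be a real symmetric n×n matrix, 1 ≤ m ≤ n, and fix an index i with 1 ≤ i ≤ n. Let S^{⟨i⟩} denote the symmetric (n−1)×(n−1) matrix obtained from S by deleting the i-th row and the i-th column. Then S ∈ K_m(n) if and only if T_m(S) > 0 and S^{⟨i⟩} ∈ K_{m−1}(n−1). -/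
open Matrix

open Polynomial in
/-- The derivative of a real-rooted polynomial is real-rooted. -/
theorem splits_derivative_real {f : ℝ[X]} (hf : f.Splits) : (derivative f).Splits := by
  rw [splits_iff_card_roots]
  have h1 := card_roots_le_derivative f
  have h2 := hf.natDegree_eq_card_roots
  have h3 := natDegree_derivative f
  have h4 := card_roots' (derivative f)
  omega

open Polynomial in
theorem splits_iterate_derivative_real {f : ℝ[X]} (hf : f.Splits) (k : ℕ) :
    (derivative^[k] f).Splits := by
  induction k with
  | zero => exact hf
  | succ k ih =>
    rw [Function.iterate_succ_apply']
    exact splits_derivative_real ih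

open Polynomial in
theorem coeff_prod_X_sub_C_pos (s : Multiset ℝ) (hs : ∀ r ∈ s, r < 0) (j : ℕ)
    (hj : j ≤ s.card) : 0 < ((s.map fun r => X - C r).prod).coeff j := by
  induction s using Multiset.induction_on generalizing j with
  | empty =>
    obtain rfl : j = 0 := by simpa using hj
    simp
  | cons a s ih =>
    have ha : 0 < -a := by linarith [hs a (Multiset.mem_cons_self a s)]
    have hlow := ih fun r hr => hs r (Multiset.mem_cons_of_mem hr)
    have hnn : ∀ l, 0 ≤ ((s.map fun r => X - C r).prod).coeff l := by
      intro l
      by_cases hl : l ≤ s.card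
      · exact (hlow l hl).le
      · rw [coeff_eq_zero_of_natDegree_lt]
        rw [natDegree_multiset_prod_X_sub_C_eq_card]
        omega
    rw [Multiset.map_cons, Multiset.prod_cons, sub_mul, coeff_sub, coeff_C_mul]
    rw [Multiset.card_cons] at hj
    cases j with
    | zero =>
      rw [coeff_X_mul_zero]
      nlinarith [mul_pos ha (hlow 0 (Nat.zero_le _))]
    | succ l =>
      rw [coeff_X_mul]
      nlinarith [hlow l (by omega), mul_nonneg ha.le (hnn (l + 1))]

open Polynomial in
/-- A real-rooted polynomial with nonnegative coefficients and positive constant coefficient has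
positive coefficients up to its degree. -/
theorem coeff_pos_of_splits_of_coeff_nonneg {f : ℝ[X]} (hf : f.Splits)
    (hnn : ∀ j, 0 ≤ f.coeff j) (h0 : 0 < f.coeff 0) (j : ℕ) (hj : j ≤ f.natDegree) :
    0 < f.coeff j := by
  have hne : f ≠ 0 := by
    rintro rfl
    simp at h0
  have hroots : ∀ r ∈ f.roots, r < 0 := by
    intro r hr
    by_contra! hr0
    have he : f.eval r = 0 := (mem_roots hne).1 hr
    rw [eval_eq_sum_range, Finset.sum_range_succ'] at he
    have : 0 ≤ ∑ k ∈ Finset.range f.natDegree, f.coeff (k + 1) * r ^ (k + 1) :=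
      Finset.sum_nonneg fun k _ => mul_nonneg (hnn _) (pow_nonneg hr0 _)
    simp only [pow_zero, mul_one] at he
    linarith
  have hlead : 0 < f.leadingCoeff :=
    lt_of_le_of_ne (hnn _) (leadingCoeff_ne_zero.2 hne).symm
  rw [hf.eq_prod_roots, coeff_C_mul]
  refine mul_pos hlead (coeff_prod_X_sub_C_pos _ hroots j ?_)
  rwa [← hf.natDegree_eq_card_roots]

/-- The `p`-traces of `S` are the coefficients of `det (X • 1 + S)`. -/
theorem coeff_charpoly_neg_s9 {ι : Type*} [Fintype ι] [DecidableEq ι] (S : Matrix ι ι ℝ) (p : ℕ)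
    (hp : p ≤ Fintype.card ι) : (-S).charpoly.coeff (Fintype.card ι - p) = ptrace p S := by
  rw [charpoly_coeff_eq_sum_minors _ _ hp, Finset.mul_sum]
  unfold ptrace
  refine Finset.sum_congr rfl fun s hs => ?_
  rw [submatrix_neg, Pi.neg_apply, Pi.neg_apply, det_neg, Fintype.card_coe,
    (Finset.mem_powersetCard.mp hs).2, ← mul_assoc, ← mul_pow]
  norm_num
  congr!

theorem ptrace_zero {ι : Type*} [Fintype ι] (S : Matrix ι ι ℝ) : ptrace 0 S = 1 := by
  simp [ptrace]

open Polynomial in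
/-- If the first `m` traces of a symmetric matrix are nonnegative and the last of them is positive,
then all of them are positive. -/
theorem ptrace_pos_of_nonneg {ι : Type*} [Fintype ι] {S : Matrix ι ι ℝ} (hS : S.IsSymm) {m : ℕ}
    (hm : m ≤ Fintype.card ι) (hnn : ∀ p ≤ m, 0 ≤ ptrace p S) (hpos : 0 < ptrace m S)
    (p : ℕ) (hp : p ≤ m) : 0 < ptrace p S := by
  classical
  have hH : (-S).IsHermitian := by
    rw [IsHermitian, conjTranspose_eq_transpose_of_trivial, transpose_neg, hS.eq]
  set k := Fintype.card ι - m with hk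
  set g : ℝ[X] := derivative^[k] (-S).charpoly with hg
  have hcoeff : ∀ j ≤ m, g.coeff j = (j + k).descFactorial k • ptrace (m - j) S := by
    intro j hj
    rw [hg, coeff_iterate_derivative, ← coeff_charpoly_neg_s9 S (m - j) (by omega)]
    congr 2
    omega
  have hfac : ∀ j, 0 < (((j + k).descFactorial k : ℕ) : ℝ) := fun j =>
    Nat.cast_pos.2 (Nat.pos_of_ne_zero (by rw [Ne, Nat.descFactorial_eq_zero_iff_lt]; omega))
  have hdeg : g.natDegree = m := by
    refine le_antisymm ((natDegree_iterate_derivative _ _).trans ?_) (le_natDegree_of_ne_zero ?_)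
    · rw [charpoly_natDegree_eq_dim]
      omega
    · rw [hcoeff m le_rfl, Nat.sub_self, ptrace_zero, nsmul_eq_mul, mul_one]
      exact (hfac m).ne'
  have hgnn : ∀ j, 0 ≤ g.coeff j := by
    intro j
    by_cases hj : j ≤ m
    · rw [hcoeff j hj, nsmul_eq_mul]
      exact mul_nonneg (hfac j).le (hnn _ (Nat.sub_le _ _))
    · rw [coeff_eq_zero_of_natDegree_lt]
      omega
  have hg0 : 0 < g.coeff 0 := by
    rw [hcoeff 0 (Nat.zero_le _), nsmul_eq_mul]
    exact mul_pos (hfac 0) hpos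
  have hsplit : g.Splits := splits_iterate_derivative_real hH.splits_charpoly k
  have := coeff_pos_of_splits_of_coeff_nonneg hsplit hgnn hg0 (m - p) (by omega)
  rw [hcoeff _ (Nat.sub_le _ _), nsmul_eq_mul, Nat.sub_sub_self hp] at this
  exact pos_of_mul_pos_right this (hfac _).le

open Polynomial in
theorem charpoly_neg_add_single {n : ℕ} (S : Matrix (Fin (n + 1)) (Fin (n + 1)) ℝ)
    (i : Fin (n + 1)) (t : ℝ) :
    (-(S + single i i t)).charpoly =
      (-S).charpoly + C t * (-(S.submatrix i.succAbove i.succAbove)).charpoly := by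
  have h : (-(S + single i i t)).charmatrix =
      (-S).charmatrix.updateRow i ((-S).charmatrix i + Pi.single i (C t)) := by
    ext1 a b
    by_cases ha : a = i
    · subst ha
      by_cases hb : b = a
      · subst hb
        simp
        ring
      · simp [hb, Ne.symm hb]
    · simp [charmatrix_apply, ha, Ne.symm ha]
  rw [charpoly, h, det_updateRow_add, updateRow_eq_self,
    det_succ_row ((-S).charmatrix.updateRow i (Pi.single i (C t))) i,
    Finset.sum_eq_single i]
  · simp only [updateRow_self, Pi.single_eq_same, charpoly]
    rw [← two_mul, pow_mul, neg_one_sq, one_pow, one_mul]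
    congr 3
    ext1 a b
    simp [charmatrix_apply, diagonal_apply, (Fin.succAbove_right_injective (p := i)).eq_iff]
  · intro b _ hb
    simp [hb]
  · simp

theorem ptrace_add_single {n : ℕ} (S : Matrix (Fin (n + 1)) (Fin (n + 1)) ℝ)
    (i : Fin (n + 1)) (t : ℝ) (p : ℕ) (hp : p ≤ n) :
    ptrace (p + 1) (S + single i i t) =
      ptrace (p + 1) S + t * ptrace p (S.submatrix i.succAbove i.succAbove) := by
  have h := congrArg (fun f => Polynomial.coeff f (n - p)) (charpoly_neg_add_single S i t)
  have e := fun M : Matrix (Fin (n + 1)) (Fin (n + 1)) ℝ =>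
    coeff_charpoly_neg_s9 M (p + 1) (by simpa using hp)
  have hminor := coeff_charpoly_neg_s9 (S.submatrix i.succAbove i.succAbove) p (by simpa using hp)
  simp only [Fintype.card_fin, Nat.add_sub_add_right] at e hminor
  simpa only [Polynomial.coeff_add, Polynomial.coeff_C_mul, e, hminor] using h

/-- At the largest `t` for which a trace of `S + t • E i i` of index below `m` vanishes, the trace
of index `m` is not positive. -/
theorem exists_ptrace_pencil_boundary {n m : ℕ} (hm : m + 2 ≤ n + 1)
    {S : Matrix (Fin (n + 1)) (Fin (n + 1)) ℝ} (hS : S.IsSymm) (i : Fin (n + 1))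
    (hA : ∀ p ≤ m, 0 < ptrace p (S.submatrix i.succAbove i.succAbove)) :
    ∃ t : ℝ,
      ptrace (m + 2) S + t * ptrace (m + 1) (S.submatrix i.succAbove i.succAbove) ≤ 0 ∧
      (∀ p ≤ m, 0 ≤ ptrace (p + 1) S + t * ptrace p (S.submatrix i.succAbove i.succAbove)) ∧
      ∃ p ≤ m, ptrace (p + 1) S + t * ptrace p (S.submatrix i.succAbove i.succAbove) = 0 := by
  set A := S.submatrix i.succAbove i.succAbove with hAdef
  obtain ⟨p, hp, hmax⟩ := Finset.exists_max_image (Finset.range (m + 1))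
    (fun p => -ptrace (p + 1) S / ptrace p A) ⟨0, by simp⟩
  have hpm : p ≤ m := by simpa [Nat.lt_succ_iff] using hp
  set t := -ptrace (p + 1) S / ptrace p A with ht
  have hzero : ptrace (p + 1) S + t * ptrace p A = 0 := by
    rw [ht, div_mul_cancel₀ _ (hA p hpm).ne']
    ring
  have hnn : ∀ q ≤ m, 0 ≤ ptrace (q + 1) S + t * ptrace q A := by
    intro q hq
    have := hmax q (by simpa [Nat.lt_succ_iff] using hq)
    rw [div_le_iff₀ (hA q hq)] at this
    linarith
  refine ⟨t, ?_, hnn, p, hpm, hzero⟩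
  by_contra! hpos
  have hsymm : (S + single i i t).IsSymm := by
    rw [IsSymm, transpose_add, hS.eq, transpose_single]
  have key := ptrace_pos_of_nonneg hsymm (m := m + 2) (by simpa using hm) ?_ ?_ (p + 1) (by omega)
  · rw [ptrace_add_single S i t p (by omega), hzero] at key
    exact lt_irrefl _ key
  · intro q hq
    rcases q with _ | q
    · rw [ptrace_zero]
      exact zero_le_one
    · rw [ptrace_add_single S i t q (by omega)]
      rcases Nat.lt_or_ge m q with h | h
      · obtain rfl : q = m + 1 := by omega
        exact hpos.le
      · exact hnn q h
  · rw [ptrace_add_single S i t (m + 1) (by omega)]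
    exact hpos

theorem ptrace_submatrix_pos {n : ℕ} {S : Matrix (Fin (n + 1)) (Fin (n + 1)) ℝ} (hS : S.IsSymm)
    (i : Fin (n + 1)) (m : ℕ) (hm : m ≤ n) (hpos : ∀ p ≤ m, 0 < ptrace (p + 1) S) :
    ∀ p ≤ m, 0 < ptrace p (S.submatrix i.succAbove i.succAbove) := by
  induction m with
  | zero =>
    intro p hp
    obtain rfl : p = 0 := by omega
    rw [ptrace_zero]
    exact one_pos
  | succ m ih =>
    have hlow := ih (by omega) fun p hp => hpos p (by omega)
    intro p hp
    rcases Nat.lt_or_ge m p with h | h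
    · obtain rfl : p = m + 1 := by omega
      obtain ⟨t, hle, -, q, hq, hz⟩ := exists_ptrace_pencil_boundary (by omega) hS i hlow
      have h1 := hpos q (by omega)
      have h2 := hlow q hq
      have h3 := hpos (m + 1) le_rfl
      have ht : t < 0 := by
        by_contra! ht
        nlinarith [mul_nonneg ht h2.le]
      by_contra! hneg
      nlinarith [mul_nonneg_of_nonpos_of_nonpos ht.le hneg]
    · exact hlow p h

/-- Sylvester criterion, single-index form: a real symmetric
`(n+1) × (n+1)` matrix `S` belongs to `K_m(n+1)` (`1 ≤ m ≤ n+1`) iff `T_m(S) > 0` and the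
matrix `S^{⟨i⟩}` obtained by deleting the `i`-th row and column belongs to `K_{m-1}(n)`. -/
theorem sylvester_criterion_single (n m : ℕ) (h1 : 1 ≤ m) (h2 : m ≤ n + 1)
    (S : Matrix (Fin (n + 1)) (Fin (n + 1)) ℝ) (hS : S.IsSymm) (i : Fin (n + 1)) :
    S ∈ gardingCone (n + 1) m ↔
      0 < ptrace m S ∧ S.submatrix i.succAbove i.succAbove ∈ gardingCone n (m - 1) := by
  obtain ⟨m, rfl⟩ : ∃ k, m = k + 1 := ⟨m - 1, by omega⟩
  have hA : (S.submatrix i.succAbove i.succAbove).IsSymm := hS.submatrix _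
  simp only [gardingCone, Set.mem_ofPred_eq, Nat.add_sub_cancel, hS, hA, true_and]
  constructor
  · intro h
    exact ⟨h _ h1 le_rfl, fun p _ hp => ptrace_submatrix_pos hS i m (by omega)
      (fun q hq => h (q + 1) (by omega) (by omega)) p hp⟩
  · rintro ⟨hm, h⟩ p hp hpm
    have hApos : ∀ q ≤ m, 0 < ptrace q (S.submatrix i.succAbove i.succAbove) := by
      intro q hq
      rcases Nat.eq_zero_or_pos q with rfl | hq0
      · rw [ptrace_zero]
        exact one_pos
      · exact h q hq0 hq
    obtain ⟨p, rfl⟩ : ∃ k, p = k + 1 := ⟨p - 1, by omega⟩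
    rcases eq_or_ne p m with rfl | hne
    · exact hm
    obtain ⟨m, rfl⟩ : ∃ k, m = k + 1 := ⟨m - 1, by omega⟩
    obtain ⟨t, hle, hnn, -⟩ := exists_ptrace_pencil_boundary (by omega) hS i
      fun q hq => hApos q (by omega)
    have ht : t < 0 := by
      by_contra! ht
      nlinarith [mul_nonneg ht (hApos (m + 1) le_rfl).le]
    nlinarith [hnn p (by omega), mul_neg_of_neg_of_pos ht (hApos p (by omega))]
end
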